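/- The non-symmetric Askey–Wilson polynomial E_{-n} := (ab/(ab−1))·(P_n − Q_n), for n ≥ 1 and ab ≠ 1, satisfies the eigenvalue equation Y E_{-n} = q^{-n} E_{-n}, where Y = T_1 T_0. -/

import Mathlib

open scoped BigOperators

noncomputable section

/-- The field of rational functions over ℂ, in which Laurent polynomials live. -/
local notation "F" => RatFunc ℂ

/-- Scalar constants in `F`. -/
def Cc (x : ℂ) : F := RatFunc.C x

/-- The variable `z`. -/
def Xv : F := RatFunc.X

/-- Substitution `z ↦ t` in a rational function (well defined since the
substitution points used here are transcendental over ℂ). -/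
def subst (t : F) (f : F) : F := RatFunc.eval (RatFunc.C) t f

/-- `f` is a Laurent polynomial in `z`. -/
def IsLaurent (f : F) : Prop :=
  ∃ (p : Polynomial ℂ) (n : ℕ), f = algebraMap (Polynomial ℂ) F p / Xv ^ n

/-- The DAHA operator `T₁` of the basic representation. -/
def T1op (a b : ℂ) (f : F) : F :=
  ((Cc a + Cc b) * Xv - (1 + Cc a * Cc b)) / (1 - Xv ^ 2) * f
    + ((1 - Cc a * Xv) * (1 - Cc b * Xv)) / (1 - Xv ^ 2) * subst Xv⁻¹ f

/-- The DAHA operator `T₀` of the basic representation. -/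
def T0op (q c d : ℂ) (f : F) : F :=
  (Cc q)⁻¹ * Xv * ((Cc c * Cc d + Cc q) * Xv - (Cc c + Cc d) * Cc q) / (Cc q - Xv ^ 2) * f
    - ((Cc c - Xv) * (Cc d - Xv)) / (Cc q - Xv ^ 2) * subst (Cc q * Xv⁻¹) f

/-- The inverse of `T₁`: `T₁⁻¹ = -(ab)⁻¹T₁ - (1 + (ab)⁻¹)`. -/
def T1inv (a b : ℂ) (f : F) : F :=
  -(Cc a * Cc b)⁻¹ * T1op a b f - (1 + (Cc a * Cc b)⁻¹) * f

/-- The inverse of `T₀`: `T₀⁻¹ = -q(cd)⁻¹T₀ - (1 + q(cd)⁻¹)`. -/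
def T0inv (q c d : ℂ) (f : F) : F :=
  -(Cc q * (Cc c * Cc d)⁻¹) * T0op q c d f - (1 + Cc q * (Cc c * Cc d)⁻¹) * f

/-- `Y = T₁T₀`. -/
def Yop (q a b c d : ℂ) (f : F) : F := T1op a b (T0op q c d f)

/-- `Y⁻¹ = T₀⁻¹T₁⁻¹`. -/
def Yinv (q a b c d : ℂ) (f : F) : F := T0inv q c d (T1inv a b f)

/-- `D = Y + q⁻¹abcd·Y⁻¹`. -/
def Dop (q a b c d : ℂ) (f : F) : F :=
  Yop q a b c d f + Cc (q⁻¹ * (a * b * c * d)) * Yinv q a b c d f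

/-- The Askey–Wilson second order q-difference operator `D_sym`. -/
def DsymOp (q a b c d : ℂ) (f : F) : F :=
  ((1 - Cc a * Xv) * (1 - Cc b * Xv) * (1 - Cc c * Xv) * (1 - Cc d * Xv)) /
      ((1 - Xv ^ 2) * (1 - Cc q * Xv ^ 2)) * (subst (Cc q * Xv) f - f)
    + ((Cc a - Xv) * (Cc b - Xv) * (Cc c - Xv) * (Cc d - Xv)) /
      ((1 - Xv ^ 2) * (Cc q - Xv ^ 2)) * (subst ((Cc q)⁻¹ * Xv) f - f)
    + (1 + (Cc q)⁻¹ * Cc a * Cc b * Cc c * Cc d) * f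

/-- q-Pochhammer symbol `(x;q)_k`. -/
def qPoch (x q : ℂ) (k : ℕ) : ℂ := ∏ j ∈ Finset.range k, (1 - x * q ^ j)

/-- The monic Askey–Wilson Laurent polynomial `P_n[z;a,b,c,d|q]`. -/
def AWP (q a b c d : ℂ) (n : ℕ) : F :=
  Cc (a⁻¹ ^ n) * ∑ k ∈ Finset.range (n + 1),
    Cc (qPoch (q⁻¹ ^ n) q k * qPoch (a * b * q ^ k) q (n - k) * qPoch (a * c * q ^ k) q (n - k)
        * qPoch (a * d * q ^ k) q (n - k) * q ^ k
        / (qPoch q q k * qPoch (a * b * c * d * q ^ (n + k) / q) q (n - k)))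
      * (∏ j ∈ Finset.range k, (1 - Cc a * Xv * Cc (q ^ j)))
      * (∏ j ∈ Finset.range k, (1 - Cc a * Xv⁻¹ * Cc (q ^ j)))

/-- `Q_n[z] := (ab)⁻¹ z⁻¹ (1-az)(1-bz) P_{n-1}[z;qa,qb,c,d|q]`. -/
def Qpoly (q a b c d : ℂ) (n : ℕ) : F :=
  (Cc (a * b))⁻¹ * Xv⁻¹ * (1 - Cc a * Xv) * (1 - Cc b * Xv) *
    AWP q (q * a) (q * b) c d (n - 1)

/-- Elementary symmetric polynomials in a,b,c,d. -/
def esym1 (a b c d : ℂ) : ℂ := a + b + c + d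
def esym2 (a b c d : ℂ) : ℂ := a*b + a*c + b*c + a*d + b*d + c*d
def esym3 (a b c d : ℂ) : ℂ := a*b*c + a*b*d + a*c*d + b*c*d
def esym4 (a b c d : ℂ) : ℂ := a*b*c*d


theorem subst_hom (t : F) (ht : Transcendental ℂ t) :
    ∃ S : F →+* F, (∀ f, subst t f = S f) ∧ S Xv = t ∧ ∀ x, S (Cc x) = Cc x := by
  have hne : ∀ p : Polynomial ℂ, p ≠ 0 → Polynomial.eval₂ (RatFunc.C) t p ≠ 0 := by
    intro p hp h
    apply hp
    apply (transcendental_iff.mp ht) p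
    rw [Polynomial.aeval_def]
    exact h
  have hd : ∀ f : F, Polynomial.eval₂ (RatFunc.C) t (RatFunc.denom f) ≠ 0 :=
    fun f => hne _ (RatFunc.denom_ne_zero f)
  refine ⟨{ toFun := subst t, map_one' := ?_, map_mul' := ?_, map_zero' := ?_, map_add' := ?_ },
    fun f => rfl, ?_, ?_⟩
  · simp [subst]
  · intro x y; exact RatFunc.eval_mul _ _ (hd x) (hd y)
  · simp [subst]
  · intro x y; exact RatFunc.eval_add _ _ (hd x) (hd y)
  · exact RatFunc.eval_X _ _
  · intro x; exact RatFunc.eval_C _ _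

theorem trans_inv : Transcendental ℂ (Xv⁻¹ : F) := by
  intro h
  exact RatFunc.transcendental_X (K := ℂ) (IsAlgebraic.inv_iff.mp h)

theorem trans_qinv (q : ℂ) (hq : q ≠ 0) : Transcendental ℂ (Cc q * Xv⁻¹ : F) := by
  intro h
  have h2 : IsAlgebraic ℂ (Cc q⁻¹ : F) := isAlgebraic_algebraMap (A := F) q⁻¹
  have h3 := h2.mul h
  have : Cc q⁻¹ * (Cc q * Xv⁻¹) = (Xv⁻¹ : F) := by
    have : Cc q⁻¹ * Cc q = 1 := by
      unfold Cc; rw [← map_mul, inv_mul_cancel₀ hq, map_one]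
    rw [← mul_assoc, this, one_mul]
  rw [this] at h3
  exact trans_inv h3

theorem Xv_ne : (Xv : F) ≠ 0 := RatFunc.X_ne_zero

theorem Cc_sub_sq_ne (x : ℂ) : Cc x - Xv ^ 2 ≠ 0 := by
  intro h
  apply RatFunc.transcendental_X (K := ℂ)
  refine ⟨Polynomial.C x - Polynomial.X ^ 2, ?_, ?_⟩
  · intro h0
    have := congrArg (fun p => Polynomial.coeff p 2) h0
    simp [Polynomial.coeff_C] at this
  · rw [map_sub, map_pow, Polynomial.aeval_C, Polynomial.aeval_X]
    exact h

/-- generic step -/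
theorem step_gen {K : Type*} [Field K] (q a b c d z Q N t t1 U : K)
    (hq : q ≠ 0) (ha : a ≠ 0) (hb : b ≠ 0) (hz : z ≠ 0) (hQ : Q ≠ 0) (hN : N ≠ 0)
    (h1 : 1 - q * Q ≠ 0)
    (ht : t1 * (1 - q * Q) * (1 - a * c * (q * Q)) * (1 - a * d * (q * Q))
      = t * q * (1 - q * Q / N) * (1 - a * b * c * d * N * Q)) :
    (1 - a * b) * (1 - a * c * Q) * (1 - a * d * Q) * ((1 - a * b * (q * Q)) * U) * t
        / (a * b * N * Q)
      + (t * q * (1 - N⁻¹) / (1 - q * Q) * ((1 - a * b * (q * Q)) * U) *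
          ((a * Q * c * d - 1 / (b * N)) * z⁻¹
            + (-(1 + a ^ 2 * Q) * c * d / q - a * Q * (c + d) + a * (c + d) / q
                + (1 + a ^ 2 * Q) / (a * b * N))
            + (a * Q * (c * d / q + 1) - a / q - Q / (b * N)) * z)
        - (a * q / N) * (t * ((1 - a * b * N) * U)) *
          ((-Q * c * d + 1 / (a * b * N)) * z⁻¹
            + (-(c + d) / (q * a * b) + (b + a * Q) * c * d / (q * a * b) + Q * (c + d)
                - (b + a * Q) / (a * b * N))
            + (1 / (q * a * b) - Q * (c * d / q + 1) + Q / N) * z))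
      = (1 - a * b) * (1 - a * c * (q * Q)) * (1 - a * d * (q * Q)) * U * t1
        / (a * b * N * (q * Q)) * ((1 - a * z * Q) * (1 - q * a * z⁻¹ * Q)) := by
  have e : (1 - a * b) * (1 - a * c * (q * Q)) * (1 - a * d * (q * Q)) * U * t1
        / (a * b * N * (q * Q)) =
      (1 - a * b) * U / (a * b * N * (q * Q)) / (1 - q * Q) *
        (t * q * (1 - q * Q / N) * (1 - a * b * c * d * N * Q)) := by
    rw [← ht]; field_simp
  rw [e]
  have h1' : 1 - Q * q ≠ 0 := by rwa [mul_comm]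
  field_simp
  ring

/-- top step -/
theorem step_top {K : Type*} [Field K] (q a b c d z Q t : K)
    (hq : q ≠ 0) (ha : a ≠ 0) (hb : b ≠ 0) (hz : z ≠ 0) (hQ : Q ≠ 0)
    (h1 : 1 - q * Q ≠ 0) :
    (1 - a * b) * (1 - a * c * Q) * (1 - a * d * Q) * 1 * t
        / (a * b * (q * Q) * Q)
      + (t * q * (1 - (q * Q)⁻¹) / (1 - q * Q) * 1 *
          ((a * Q * c * d - 1 / (b * (q * Q))) * z⁻¹
            + (-(1 + a ^ 2 * Q) * c * d / q - a * Q * (c + d) + a * (c + d) / q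
                + (1 + a ^ 2 * Q) / (a * b * (q * Q)))
            + (a * Q * (c * d / q + 1) - a / q - Q / (b * (q * Q))) * z)
        - (a * q / (q * Q)) * (t * 1) *
          ((-Q * c * d + 1 / (a * b * (q * Q))) * z⁻¹
            + (-(c + d) / (q * a * b) + (b + a * Q) * c * d / (q * a * b) + Q * (c + d)
                - (b + a * Q) / (a * b * (q * Q)))
            + (1 / (q * a * b) - Q * (c * d / q + 1) + Q / (q * Q)) * z))
      = 0 := by
  have h1' : 1 - Q * q ≠ 0 := by rwa [mul_comm]
  field_simp
  ring

/-- X-coefficient -/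
def XX (q a b c d N Q : F) : F := (a * Q * c * d - 1 / (b * N)) * Xv⁻¹
            + (-(1 + a ^ 2 * Q) * c * d / q - a * Q * (c + d) + a * (c + d) / q
                + (1 + a ^ 2 * Q) / (a * b * N))
            + (a * Q * (c * d / q + 1) - a / q - Q / (b * N)) * Xv

/-- Y-coefficient -/
def YY (q a b c d N Q : F) : F := (-Q * c * d + 1 / (a * b * N)) * Xv⁻¹
            + (-(c + d) / (q * a * b) + (b + a * Q) * c * d / (q * a * b) + Q * (c + d)
                - (b + a * Q) / (a * b * N))
            + (1 / (q * a * b) - Q * (c * d / q + 1) + Q / N) * Xv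

/-- the T0-symmetric basis -/
def sig (q a : F) (k : ℕ) : F :=
  ∏ j ∈ Finset.range k, ((1 - a * Xv * q ^ j) * (1 - q * a * Xv⁻¹ * q ^ j))

/-- abstract telescoping -/
theorem telescope (q a b c d : F) (M : ℕ) (t A B : ℕ → F)
    (hq : q ≠ 0) (ha : a ≠ 0) (hb : b ≠ 0) (h1 : ∀ k, 1 - q ^ (k + 1) ≠ 0)
    (ht : ∀ k < M, t (k + 1) * (1 - q * q ^ k) * (1 - a * c * (q * q ^ k))
        * (1 - a * d * (q * q ^ k))
      = t k * q * (1 - q * q ^ k / q ^ (M + 1)) * (1 - a * b * c * d * q ^ (M + 1) * q ^ k))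
    (hA : ∀ k < M, A k = (1 - a * b * (q * q ^ k)) * A (k + 1))
    (hB : ∀ k < M, B k = (1 - a * b * q ^ (M + 1)) * A (k + 1))
    (hAM : A M = 1) (hBM : B M = 1) :
    (1 - a * b) * (1 - a * c) * (1 - a * d) * A 0 * t 0 / (a * b * q ^ (M + 1))
      + ∑ k ∈ Finset.range (M + 1), sig q a k *
        (t k * q * (1 - (q ^ (M + 1))⁻¹) / (1 - q * q ^ k) * A k * XX q a b c d (q ^ (M + 1)) (q ^ k)
          - (a * q / q ^ (M + 1)) * (t k * B k) * YY q a b c d (q ^ (M + 1)) (q ^ k)) = 0 := by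
  have key : ∀ m ≤ M, (1 - a * b) * (1 - a * c) * (1 - a * d) * A 0 * t 0 / (a * b * q ^ (M + 1))
      + ∑ k ∈ Finset.range m, sig q a k *
        (t k * q * (1 - (q ^ (M + 1))⁻¹) / (1 - q * q ^ k) * A k * XX q a b c d (q ^ (M + 1)) (q ^ k)
          - (a * q / q ^ (M + 1)) * (t k * B k) * YY q a b c d (q ^ (M + 1)) (q ^ k))
      = (1 - a * b) * (1 - a * c * q ^ m) * (1 - a * d * q ^ m) * A m * t m
        / (a * b * q ^ (M + 1) * q ^ m) * sig q a m := by
    intro m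
    induction m with
    | zero => intro _; simp [sig]
    | succ m ih =>
      intro hm
      rw [Finset.sum_range_succ, ← add_assoc, ih (by omega)]
      have hs : sig q a (m + 1) = sig q a m *
          ((1 - a * Xv * q ^ m) * (1 - q * a * Xv⁻¹ * q ^ m)) := by
        simp [sig, Finset.prod_range_succ]
      have h1' : 1 - q * q ^ m ≠ 0 := by have := h1 m; rwa [pow_succ'] at this
      have st := step_gen q a b c d Xv (q ^ m) (q ^ (M + 1)) (t m) (t (m + 1)) (A (m + 1))
        hq ha hb Xv_ne (pow_ne_zero _ hq) (pow_ne_zero _ hq) h1' (ht m (by omega))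
      rw [hs, hA m (by omega), hB m (by omega), pow_succ' q m]
      unfold XX YY
      linear_combination (sig q a m) * st
  rw [Finset.sum_range_succ, ← add_assoc, key M le_rfl, hAM, hBM]
  have h1' : 1 - q * q ^ M ≠ 0 := by have := h1 M; rwa [pow_succ'] at this
  have st := step_top q a b c d Xv (q ^ M) (t M) hq ha hb Xv_ne (pow_ne_zero _ hq) h1'
  rw [pow_succ' q M]
  unfold XX YY
  linear_combination (sig q a M) * st

theorem phi_eq (q a : ℂ) (k : ℕ) :
    (∏ j ∈ Finset.range (k + 1), (1 - Cc a * Xv * Cc (q ^ j))) *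
      (∏ j ∈ Finset.range (k + 1), (1 - Cc a * Xv⁻¹ * Cc (q ^ j)))
    = sig (Cc q) (Cc a) k * ((1 - Cc a * Cc q ^ k * Xv) * (1 - Cc a * Xv⁻¹)) := by
  have h0 : ∀ j, Cc (q ^ j) = Cc q ^ j := fun j => by simp [Cc]
  have e : ∀ j, Cc a * Xv⁻¹ * Cc q ^ (j + 1) = Cc q * Cc a * Xv⁻¹ * Cc q ^ j := by
    intro j; ring
  simp only [h0]
  rw [Finset.prod_range_succ, Finset.prod_range_succ', sig, Finset.prod_mul_distrib]
  simp only [e, pow_zero]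
  ring

theorem psi_eq (q a : ℂ) (k : ℕ) :
    (1 - Cc a * Xv) * ((∏ j ∈ Finset.range k, (1 - Cc (q * a) * Xv * Cc (q ^ j))) *
      (∏ j ∈ Finset.range k, (1 - Cc (q * a) * Xv⁻¹ * Cc (q ^ j))))
    = sig (Cc q) (Cc a) k * (1 - Cc a * Cc q ^ k * Xv) := by
  have h0 : ∀ j, Cc (q ^ j) = Cc q ^ j := fun j => by simp [Cc]
  have h1 : Cc (q * a) = Cc q * Cc a := by simp [Cc]
  have h2 := Finset.prod_range_succ (fun j => (1 - Cc a * Xv * Cc q ^ j)) k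
  have h3 := Finset.prod_range_succ' (fun j => (1 - Cc a * Xv * Cc q ^ j)) k
  rw [h2] at h3
  have e : ∀ j, Cc a * Xv * Cc q ^ (j + 1) = Cc q * Cc a * Xv * Cc q ^ j := by
    intro j; ring
  simp only [h0, h1, sig, Finset.prod_mul_distrib]
  simp only [e, pow_zero, mul_one] at h3
  linear_combination (-(∏ j ∈ Finset.range k, (1 - Cc q * Cc a * Xv⁻¹ * Cc q ^ j))) * h3

/-- common coefficient -/
def tt (q a b c d : ℂ) (M k : ℕ) : ℂ :=
  qPoch (q⁻¹ ^ M) q k * qPoch (a * c * q ^ (k + 1)) q (M - k) * qPoch (a * d * q ^ (k + 1)) q (M - k)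
    * q ^ k / (qPoch q q k * qPoch (a * b * c * d * q ^ (M + 1 + k)) q (M - k))

theorem qPoch_succ (x q : ℂ) (k : ℕ) : qPoch x q (k + 1) = qPoch x q k * (1 - x * q ^ k) := by
  simp [qPoch, Finset.prod_range_succ]

theorem qPoch_succ' (x q : ℂ) (k : ℕ) : qPoch x q (k + 1) = (1 - x) * qPoch (x * q) q k := by
  rw [qPoch, Finset.prod_range_succ', qPoch, mul_comm]
  simp only [pow_zero, mul_one]
  congr 1
  apply Finset.prod_congr rfl
  intro j _
  ring

theorem qPoch_ne (x q : ℂ) (k : ℕ) (h : ∀ j < k, x * q ^ j ≠ 1) : qPoch x q k ≠ 0 := by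
  rw [qPoch, Finset.prod_ne_zero_iff]
  intro j hj h0
  exact h j (Finset.mem_range.mp hj) (sub_eq_zero.mp h0).symm

theorem abcd_pow_ne (q x : ℂ) (hq : q ≠ 0) (h : ∀ m : ℕ, x ≠ q⁻¹ ^ m) (j : ℕ) :
    x * q ^ j ≠ 1 := by
  intro h0
  apply h j
  rw [inv_pow]
  exact eq_inv_of_mul_eq_one_left h0

theorem tt_rec (q a b c d : ℂ) (M k : ℕ) (hk : k < M) (hq : q ≠ 0)
    (hroot : ∀ m : ℕ, 1 ≤ m → q ^ m ≠ 1) (habcd : ∀ m : ℕ, a * b * c * d ≠ q⁻¹ ^ m) :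
    tt q a b c d M (k + 1) * (1 - q * q ^ k) * (1 - a * c * (q * q ^ k))
        * (1 - a * d * (q * q ^ k))
      = tt q a b c d M k * q * (1 - q * q ^ k / q ^ (M + 1))
        * (1 - a * b * c * d * q ^ (M + 1) * q ^ k) := by
  obtain ⟨l, rfl⟩ : ∃ l, M = k + 1 + l := ⟨M - (k + 1), by omega⟩
  have e1 : k + 1 + l - k = l + 1 := by omega
  have e2 : k + 1 + l - (k + 1) = l := by omega
  simp only [tt, e1, e2]
  rw [qPoch_succ' (a * c * q ^ (k + 1)), qPoch_succ' (a * d * q ^ (k + 1)),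
    qPoch_succ' (a * b * c * d * q ^ (k + 1 + l + 1 + k)), qPoch_succ _ _ k, qPoch_succ q q k]
  have g1 : a * c * q ^ (k + 1) * q = a * c * q ^ (k + 1 + 1) := by ring
  have g2 : a * d * q ^ (k + 1) * q = a * d * q ^ (k + 1 + 1) := by ring
  have g3 : a * b * c * d * q ^ (k + 1 + l + 1 + k) * q
    = a * b * c * d * q ^ (k + 1 + l + 1 + (k + 1)) := by ring
  have g4 : q * q ^ k / q ^ (k + 1 + l + 1) = q⁻¹ ^ (k + 1 + l) * q ^ k := by
    rw [inv_pow, pow_succ' q (k + 1 + l)]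
    field_simp
  rw [g1, g2, g3, g4]
  have n1 : qPoch q q k ≠ 0 := qPoch_ne _ _ _ (fun j _ => by
    rw [← pow_succ']; exact hroot _ (by omega))
  have n2 : 1 - q * q ^ k ≠ 0 := by
    rw [← pow_succ']; exact sub_ne_zero.mpr (hroot _ (by omega)).symm
  have n3 : qPoch (a * b * c * d * q ^ (k + 1 + l + 1 + (k + 1))) q l ≠ 0 :=
    qPoch_ne _ _ _ (fun j _ => by
      rw [mul_assoc _ (q ^ _), ← pow_add]; exact abcd_pow_ne _ _ hq habcd _)
  have n4 : 1 - a * b * c * d * q ^ (k + 1 + l + 1 + k) ≠ 0 :=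
    sub_ne_zero.mpr (abcd_pow_ne _ _ hq habcd _).symm
  have g5 : a * b * c * d * q ^ (k + 1 + l + 1) * q ^ k
    = a * b * c * d * q ^ (k + 1 + l + 1 + k) := by ring
  rw [g5]
  rw [pow_succ' q k] at *
  generalize q ^ k = y at *
  generalize qPoch q q k = w1 at *
  generalize qPoch (a * b * c * d * q ^ (k + 1 + l + 1 + (k + 1))) q l = w2 at *
  generalize a * b * c * d * q ^ (k + 1 + l + 1 + k) = w3 at *
  generalize q⁻¹ ^ (k + 1 + l) = w4 at *
  generalize hw5 : 1 - q * y = w5 at *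
  field_simp

theorem p_succ (q a b c d : ℂ) (M k : ℕ) (hq : q ≠ 0) :
    qPoch (q⁻¹ ^ (M + 1)) q (k + 1) * qPoch (a * b * q ^ (k + 1)) q (M + 1 - (k + 1))
        * qPoch (a * c * q ^ (k + 1)) q (M + 1 - (k + 1))
        * qPoch (a * d * q ^ (k + 1)) q (M + 1 - (k + 1)) * q ^ (k + 1)
        / (qPoch q q (k + 1) * qPoch (a * b * c * d * q ^ (M + 1 + (k + 1)) / q) q (M + 1 - (k + 1)))
    = tt q a b c d M k * q * (1 - (q ^ (M + 1))⁻¹) / (1 - q * q ^ k)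
        * qPoch (a * b * q ^ (k + 1)) q (M - k) := by
  rw [qPoch_succ' (q⁻¹ ^ (M + 1)), qPoch_succ q q k, Nat.add_sub_add_right]
  have g1 : q⁻¹ ^ (M + 1) * q = q⁻¹ ^ M := by rw [pow_succ, mul_assoc, inv_mul_cancel₀ hq, mul_one]
  have g2 : a * b * c * d * q ^ (M + 1 + (k + 1)) / q = a * b * c * d * q ^ (M + 1 + k) := by
    rw [← add_assoc, pow_succ]; field_simp
  rw [g1, g2, tt, inv_pow q (M + 1), pow_succ q k]
  simp only [div_eq_mul_inv, mul_inv]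
  ring

theorem r_eq (q a b c d : ℂ) (M k : ℕ) (hq : q ≠ 0) :
    qPoch (q⁻¹ ^ M) q k * qPoch (q * a * (q * b) * q ^ k) q (M - k)
        * qPoch (q * a * c * q ^ k) q (M - k)
        * qPoch (q * a * d * q ^ k) q (M - k) * q ^ k
        / (qPoch q q k * qPoch (q * a * (q * b) * c * d * q ^ (M + k) / q) q (M - k))
    = tt q a b c d M k * qPoch (a * b * q ^ (k + 2)) q (M - k) := by
  have g1 : q * a * (q * b) * q ^ k = a * b * q ^ (k + 2) := by ring
  have g2 : q * a * c * q ^ k = a * c * q ^ (k + 1) := by ring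
  have g3 : q * a * d * q ^ k = a * d * q ^ (k + 1) := by ring
  have g4 : q * a * (q * b) * c * d * q ^ (M + k) / q = a * b * c * d * q ^ (M + 1 + k) := by
    field_simp; ring
  rw [g1, g2, g3, g4, tt]
  ring

theorem p_zero (q a b c d : ℂ) (M : ℕ) (hq : q ≠ 0)
    (habcd : ∀ m : ℕ, a * b * c * d ≠ q⁻¹ ^ m) :
    qPoch (q⁻¹ ^ (M + 1)) q 0 * qPoch (a * b * q ^ 0) q (M + 1 - 0)
        * qPoch (a * c * q ^ 0) q (M + 1 - 0)
        * qPoch (a * d * q ^ 0) q (M + 1 - 0) * q ^ 0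
        / (qPoch q q 0 * qPoch (a * b * c * d * q ^ (M + 1 + 0) / q) q (M + 1 - 0))
      * (1 - a * b * c * d * q ^ M)
    = (1 - a * b) * (1 - a * c) * (1 - a * d) * qPoch (a * b * q ^ (0 + 1)) q (M - 0)
      * tt q a b c d M 0 := by
  have g2 : a * b * c * d * q ^ (M + 1 + 0) / q = a * b * c * d * q ^ M := by
    rw [add_zero, pow_succ]; field_simp
  have g3 : a * b * c * d * q ^ M * q = a * b * c * d * q ^ (M + 1) := by ring
  rw [g2, tt]
  simp only [Nat.sub_zero, pow_zero, mul_one, add_zero, zero_add, pow_one]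
  rw [qPoch_succ' (a * b), qPoch_succ' (a * c), qPoch_succ' (a * d), qPoch_succ' (a * b * c * d * q ^ M),
    g3]
  have n4 : 1 - a * b * c * d * q ^ M ≠ 0 :=
    sub_ne_zero.mpr (abcd_pow_ne _ _ hq habcd _).symm
  have n1 : qPoch q q 0 ≠ 0 := by simp [qPoch]
  have n0 : ∀ x, qPoch x q 0 = 1 := by simp [qPoch]
  rw [n0, n0, n0]
  generalize a * b * c * d * q ^ M = w at *
  have : 1 - w ≠ 0 := n4
  simp only [div_eq_mul_inv, mul_inv, one_mul, inv_one]
  linear_combination ((1 - a * b) * (1 - a * c) * (1 - a * d) * qPoch (a * b * q) q M *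
    qPoch (a * c * q) q M * qPoch (a * d * q) q M *
    (qPoch (a * b * c * d * q ^ (M + 1)) q M)⁻¹) * mul_inv_cancel₀ this

/-- T0 on the expansion in the symmetric basis -/
theorem T0_lemma (q a b c d : ℂ) (M : ℕ) (hq : q ≠ 0) (ha : a ≠ 0) (hb : b ≠ 0)
    (p0 α β : ℂ) (u v : ℕ → ℂ) :
    T0op q c d (Cc α * (Cc p0 + ∑ k ∈ Finset.range (M + 1), Cc (u k) * (sig (Cc q) (Cc a) k *
        ((1 - Cc a * Cc q ^ k * Xv) * (1 - Cc a * Xv⁻¹))))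
      - Cc β * ∑ k ∈ Finset.range (M + 1), Cc (v k) * (sig (Cc q) (Cc a) k *
        ((1 - Cc a * Cc q ^ k * Xv) * (1 - Cc b * Xv) / (Cc a * Cc b * Xv))))
    = (Cc α * (-Cc p0 * Cc c * Cc d / Cc q + ∑ k ∈ Finset.range (M + 1),
          sig (Cc q) (Cc a) k * (Cc (u k) *
            XX (Cc q) (Cc a) (Cc b) (Cc c) (Cc d) (Cc q ^ (M + 1)) (Cc q ^ k)))
        - Cc β * ∑ k ∈ Finset.range (M + 1), sig (Cc q) (Cc a) k * (Cc (v k) *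
            YY (Cc q) (Cc a) (Cc b) (Cc c) (Cc d) (Cc q ^ (M + 1)) (Cc q ^ k)))
      - (Cc α * (∑ k ∈ Finset.range (M + 1), Cc (u k) * (sig (Cc q) (Cc a) k *
        ((1 - Cc a * Cc q ^ k * Xv) * (1 - Cc a * Xv⁻¹))))) / (Cc a * Cc b * Cc q ^ (M + 1))
      + (Cc β * ∑ k ∈ Finset.range (M + 1), Cc (v k) * (sig (Cc q) (Cc a) k *
        ((1 - Cc a * Cc q ^ k * Xv) * (1 - Cc b * Xv) / (Cc a * Cc b * Xv)))) / Cc q ^ (M + 1) := by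
  obtain ⟨S, hS, hSX, hSC⟩ := subst_hom _ (trans_qinv q hq)
  have hne := Cc_sub_sq_ne q
  have hcq : Cc q ≠ 0 := by simpa [Cc] using hq
  have hca : Cc a ≠ 0 := by simpa [Cc] using ha
  have hcb : Cc b ≠ 0 := by simpa [Cc] using hb
  have hX := Xv_ne
  have hsig : ∀ k, S (sig (Cc q) (Cc a) k) = sig (Cc q) (Cc a) k := by
    intro k
    simp only [sig, map_prod, map_mul, map_sub, map_one, map_pow, map_inv₀, hSX, hSC]
    apply Finset.prod_congr rfl
    intro j _
    field_simp
  simp only [T0op, hS]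
  simp only [map_sub, map_add, map_mul, map_sum, map_div₀, map_pow, map_one, map_inv₀, hSX, hSC, hsig]
  have hwne : Cc q ^ (M + 1) ≠ 0 := pow_ne_zero _ hcq
  generalize Cc q ^ (M + 1) = w at *
  generalize hA : (Cc q)⁻¹ * Xv * ((Cc c * Cc d + Cc q) * Xv - (Cc c + Cc d) * Cc q) / (Cc q - Xv ^ 2)
    = A
  generalize hB : (Cc c - Xv) * (Cc d - Xv) / (Cc q - Xv ^ 2) = B
  have E1 : A - B = - Cc c * Cc d / Cc q := by
    rw [← hA, ← hB]
    field_simp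
    ring
  have E2 : ∀ Q : F, A * ((1 - Cc a * Q * Xv) * (1 - Cc a * Xv⁻¹))
      - B * ((1 - Cc a * Q * (Cc q * Xv⁻¹)) * (1 - Cc a * (Cc q * Xv⁻¹)⁻¹))
      = XX (Cc q) (Cc a) (Cc b) (Cc c) (Cc d) w Q
        - ((1 - Cc a * Q * Xv) * (1 - Cc a * Xv⁻¹)) / (Cc a * Cc b * w) := by
    intro Q
    rw [← hA, ← hB, XX]
    field_simp
    ring
  have E3 : ∀ Q : F, A * ((1 - Cc a * Q * Xv) * (1 - Cc b * Xv) / (Cc a * Cc b * Xv))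
      - B * ((1 - Cc a * Q * (Cc q * Xv⁻¹)) * (1 - Cc b * (Cc q * Xv⁻¹)) /
          (Cc a * Cc b * (Cc q * Xv⁻¹)))
      = YY (Cc q) (Cc a) (Cc b) (Cc c) (Cc d) w Q
        - ((1 - Cc a * Q * Xv) * (1 - Cc b * Xv) / (Cc a * Cc b * Xv)) / w := by
    intro Q
    rw [← hA, ← hB, YY]
    field_simp
    ring
  have comb : ∀ (u : ℕ → ℂ) (x x' X : ℕ → F) (e : F),
      (∀ k, A * x k - B * x' k = X k - x k / e) →
      A * (∑ k ∈ Finset.range (M + 1), Cc (u k) * (sig (Cc q) (Cc a) k * x k))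
      - B * (∑ k ∈ Finset.range (M + 1), Cc (u k) * (sig (Cc q) (Cc a) k * x' k))
      = (∑ k ∈ Finset.range (M + 1), sig (Cc q) (Cc a) k * (Cc (u k) * X k))
       - (∑ k ∈ Finset.range (M + 1), Cc (u k) * (sig (Cc q) (Cc a) k * x k)) / e := by
    intro u x x' X e h
    rw [Finset.mul_sum, Finset.mul_sum, Finset.sum_div, ← Finset.sum_sub_distrib,
      ← Finset.sum_sub_distrib]
    apply Finset.sum_congr rfl
    intro k _
    linear_combination (Cc (u k) * sig (Cc q) (Cc a) k) * h k
  have F1 := comb u _ _ _ _ (fun k => E2 (Cc q ^ k))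
  have F2 := comb v _ _ _ _ (fun k => E3 (Cc q ^ k))
  linear_combination Cc α * Cc p0 * E1 + Cc α * F1 - Cc β * F2

theorem AWP_inv (q a b c d : ℂ) (n : ℕ) (S : F →+* F) (hX : S Xv = Xv⁻¹) (hC : ∀ x, S (Cc x) = Cc x) :
    S (AWP q a b c d n) = AWP q a b c d n := by
  simp only [AWP, map_mul, map_sum, map_prod, map_sub, map_one, map_inv₀, hX, hC, inv_inv]
  congr 1
  apply Finset.sum_congr rfl
  intro k _
  ring

theorem T1_lemma (q a b c d κ : ℂ) (n : ℕ) (hq : q ≠ 0) (ha : a ≠ 0) (hb : b ≠ 0) (w : ℂ) :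
    T1op a b (Cc w * (Cc κ * (Qpoly q a b c d n - AWP q a b c d n / (Cc a * Cc b))))
      = Cc w * (Cc κ * (AWP q a b c d n - Qpoly q a b c d n)) := by
  obtain ⟨S, hS, hSX, hSC⟩ := subst_hom _ trans_inv
  have hne : 1 - Xv ^ 2 ≠ 0 := by simpa [Cc] using Cc_sub_sq_ne 1
  have hca : Cc a ≠ 0 := by simpa [Cc] using ha
  have hcb : Cc b ≠ 0 := by simpa [Cc] using hb
  have hX := Xv_ne
  have hab : Cc (a * b) = Cc a * Cc b := by simp [Cc]
  simp only [T1op, hS, Qpoly]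
  simp only [map_sub, map_mul, map_div₀, map_one, map_inv₀, hSX, hSC, AWP_inv _ _ _ _ _ _ S hSX hSC,
    hab]
  field_simp
  ring

theorem AWP_exp (q a b c d : ℂ) (M : ℕ) (hq : q ≠ 0) :
    AWP q a b c d (M + 1) = Cc (a⁻¹ ^ (M + 1)) * (Cc (qPoch (q⁻¹ ^ (M + 1)) q 0 * qPoch (a * b * q ^ 0) q (M + 1 - 0)
        * qPoch (a * c * q ^ 0) q (M + 1 - 0)
        * qPoch (a * d * q ^ 0) q (M + 1 - 0) * q ^ 0
        / (qPoch q q 0 * qPoch (a * b * c * d * q ^ (M + 1 + 0) / q) q (M + 1 - 0)))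
      + ∑ k ∈ Finset.range (M + 1), Cc (tt q a b c d M k * q * (1 - (q ^ (M + 1))⁻¹) / (1 - q * q ^ k)
        * qPoch (a * b * q ^ (k + 1)) q (M - k)) * (sig (Cc q) (Cc a) k *
        ((1 - Cc a * Cc q ^ k * Xv) * (1 - Cc a * Xv⁻¹)))) := by
  rw [AWP, Finset.sum_range_succ', add_comm (∑ k ∈ _, _)]
  congr 1
  congr 1
  · simp only [Finset.range_zero, Finset.prod_empty, mul_one]
  · apply Finset.sum_congr rfl
    intro k _
    rw [← phi_eq, p_succ q a b c d M k hq, mul_assoc]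

theorem Qpoly_exp (q a b c d : ℂ) (M : ℕ) (hq : q ≠ 0) :
    Qpoly q a b c d (M + 1) = Cc ((q * a)⁻¹ ^ M) * 
      ∑ k ∈ Finset.range (M + 1), Cc (tt q a b c d M k * qPoch (a * b * q ^ (k + 2)) q (M - k)) *
        (sig (Cc q) (Cc a) k *
        ((1 - Cc a * Cc q ^ k * Xv) * (1 - Cc b * Xv) / (Cc a * Cc b * Xv))) := by
  have hab : Cc (a * b) = Cc a * Cc b := by simp [Cc]
  rw [Qpoly, AWP, Nat.add_sub_cancel, mul_left_comm, Finset.mul_sum, hab]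
  congr 1
  apply Finset.sum_congr rfl
  intro k _
  rw [r_eq q a b c d M k hq]
  simp only [div_eq_mul_inv, mul_inv]
  linear_combination (Cc (tt q a b c d M k * qPoch (a * b * q ^ (k + 2)) q (M - k)) *
    ((Cc a)⁻¹ * (Cc b)⁻¹ * Xv⁻¹ * (1 - Cc b * Xv))) * psi_eq q a k

theorem main_lemma (q a b c d κ : ℂ) (M : ℕ) (hq : q ≠ 0)
    (hroot : ∀ m : ℕ, 1 ≤ m → q ^ m ≠ 1) (ha : a ≠ 0) (hb : b ≠ 0)
    (habcd : ∀ m : ℕ, a * b * c * d ≠ q⁻¹ ^ m) :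
    T0op q c d (Cc κ * (AWP q a b c d (M + 1) - Qpoly q a b c d (M + 1)))
      = Cc ((q ^ (M + 1))⁻¹) * (Cc κ * (Qpoly q a b c d (M + 1)
          - AWP q a b c d (M + 1) / (Cc a * Cc b))) := by
  have hcq : Cc q ≠ 0 := by simpa [Cc] using hq
  have hca : Cc a ≠ 0 := by simpa [Cc] using ha
  have hcb : Cc b ≠ 0 := by simpa [Cc] using hb
  have cm : ∀ x y, Cc (x * y) = Cc x * Cc y := fun x y => by simp [Cc]
  have cs : ∀ x y, Cc (x - y) = Cc x - Cc y := fun x y => by simp [Cc]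
  have cd' : ∀ x y, Cc (x / y) = Cc x / Cc y := fun x y => by simp [Cc]
  have cp : ∀ x (n : ℕ), Cc (x ^ n) = Cc x ^ n := fun x y => by simp [Cc]
  have ci : ∀ x, Cc (x⁻¹) = (Cc x)⁻¹ := fun x => by simp [Cc]
  have c1 : Cc 1 = 1 := by simp [Cc]
  have tel := telescope (Cc q) (Cc a) (Cc b) (Cc c) (Cc d) M (fun k => Cc (tt q a b c d M k))
    (fun k => Cc (qPoch (a * b * q ^ (k + 1)) q (M - k)))
    (fun k => Cc (qPoch (a * b * q ^ (k + 2)) q (M - k))) hcq hca hcb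
    (by
      intro k h
      apply hroot (k + 1) (by omega)
      have : Cc (1 - q ^ (k + 1)) = 0 := by rw [cs, c1, cp]; exact h
      have h2 : 1 - q ^ (k + 1) = 0 := (map_eq_zero (RatFunc.C (K := ℂ))).mp this
      exact (sub_eq_zero.mp h2).symm)
    (by
      intro k hk
      have := congrArg Cc (tt_rec q a b c d M k hk hq hroot habcd)
      simpa only [cm, cs, cd', cp, c1] using this)
    (by
      intro k hk
      have e : M - k = (M - (k + 1)) + 1 := by omega
      have : qPoch (a * b * q ^ (k + 1)) q (M - k) = (1 - a * b * (q * q ^ k)) *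
          qPoch (a * b * q ^ (k + 1 + 1)) q (M - (k + 1)) := by
        rw [e, qPoch_succ', pow_succ' q k, pow_succ q (k + 1), pow_succ' q k, mul_assoc (a * b)]
      have := congrArg Cc this
      simpa only [cm, cs, cd', cp, c1] using this)
    (by
      intro k hk
      have e : M - k = (M - (k + 1)) + 1 := by omega
      have e2 : q ^ (M + 1) = q ^ (k + 2) * q ^ (M - (k + 1)) := by
        rw [← pow_add]; congr 1; omega
      have : qPoch (a * b * q ^ (k + 2)) q (M - k) = (1 - a * b * q ^ (M + 1)) *
          qPoch (a * b * q ^ (k + 1 + 1)) q (M - (k + 1)) := by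
        rw [e, qPoch_succ, e2]
        ring
      have := congrArg Cc this
      simpa only [cm, cs, cd', cp, c1] using this)
    (by simp [qPoch, Cc]) (by simp [qPoch, Cc])
  have hp0 := congrArg Cc (p_zero q a b c d M hq habcd)
  rw [AWP_exp q a b c d M hq, Qpoly_exp q a b c d M hq]
  generalize qPoch (q⁻¹ ^ (M + 1)) q 0 * qPoch (a * b * q ^ 0) q (M + 1 - 0)
        * qPoch (a * c * q ^ 0) q (M + 1 - 0)
        * qPoch (a * d * q ^ 0) q (M + 1 - 0) * q ^ 0
        / (qPoch q q 0 * qPoch (a * b * c * d * q ^ (M + 1 + 0) / q) q (M + 1 - 0)) = p0 at *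
  have hT := T0_lemma q a b c d M hq ha hb p0 (κ * a⁻¹ ^ (M + 1)) (κ * (q * a)⁻¹ ^ M)
    (fun k => tt q a b c d M k * q * (1 - (q ^ (M + 1))⁻¹) / (1 - q * q ^ k)
        * qPoch (a * b * q ^ (k + 1)) q (M - k))
    (fun k => tt q a b c d M k * qPoch (a * b * q ^ (k + 2)) q (M - k))
  have hβ : Cc (κ * (q * a)⁻¹ ^ M) = Cc (κ * a⁻¹ ^ (M + 1)) * (Cc a * Cc q / Cc q ^ (M + 1)) := by
    rw [← cp, ← cm a, ← cd', ← cm]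
    congr 1
    rw [pow_succ, pow_succ, inv_pow, inv_pow, mul_pow]
    field_simp
  have zero : Cc (κ * a⁻¹ ^ (M + 1)) * (-Cc p0 * Cc c * Cc d / Cc q + Cc p0 / (Cc a * Cc b * Cc q ^ (M + 1))
      + ∑ k ∈ Finset.range (M + 1),
          sig (Cc q) (Cc a) k * (Cc (tt q a b c d M k * q * (1 - (q ^ (M + 1))⁻¹) / (1 - q * q ^ k)
        * qPoch (a * b * q ^ (k + 1)) q (M - k)) *
            XX (Cc q) (Cc a) (Cc b) (Cc c) (Cc d) (Cc q ^ (M + 1)) (Cc q ^ k)))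
        - Cc (κ * (q * a)⁻¹ ^ M) * ∑ k ∈ Finset.range (M + 1), sig (Cc q) (Cc a) k *
          (Cc (tt q a b c d M k * qPoch (a * b * q ^ (k + 2)) q (M - k)) *
            YY (Cc q) (Cc a) (Cc b) (Cc c) (Cc d) (Cc q ^ (M + 1)) (Cc q ^ k)) = 0 := by
    rw [hβ, mul_assoc (Cc (κ * a⁻¹ ^ (M + 1))), ← mul_sub, Finset.mul_sum, add_sub_assoc,
      ← Finset.sum_sub_distrib]
    apply mul_eq_zero_of_right
    rw [← tel]
    congr 1
    · simp only [cm, cs, cp, c1] at hp0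
      have : (1 - Cc a * Cc b) * (1 - Cc a * Cc c) * (1 - Cc a * Cc d) *
          Cc (qPoch (a * b * q ^ (0 + 1)) q (M - 0)) * Cc (tt q a b c d M 0)
          = Cc p0 * (1 - Cc a * Cc b * Cc c * Cc d * Cc q ^ M) := hp0.symm
      rw [this, pow_succ]
      field_simp
      ring
    · apply Finset.sum_congr rfl
      intro k _
      simp only [cm, cs, cd', cp, c1, ci]
      ring
  simp only [cm κ] at hT zero
  rw [ci (q ^ (M + 1)), cp q (M + 1)]
  have e0 : Cc κ * (Cc (a⁻¹ ^ (M + 1)) * (Cc p0 + ∑ k ∈ Finset.range (M + 1), Cc (tt q a b c d M k * q * (1 - (q ^ (M + 1))⁻¹) / (1 - q * q ^ k)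
        * qPoch (a * b * q ^ (k + 1)) q (M - k)) * (sig (Cc q) (Cc a) k *
        ((1 - Cc a * Cc q ^ k * Xv) * (1 - Cc a * Xv⁻¹)))) - Cc ((q * a)⁻¹ ^ M) * 
      ∑ k ∈ Finset.range (M + 1), Cc (tt q a b c d M k * qPoch (a * b * q ^ (k + 2)) q (M - k)) *
        (sig (Cc q) (Cc a) k *
        ((1 - Cc a * Cc q ^ k * Xv) * (1 - Cc b * Xv) / (Cc a * Cc b * Xv)))) = _ :=
    (mul_sub _ _ _).trans (congrArg₂ _ (mul_assoc _ _ _).symm (mul_assoc _ _ _).symm)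
  rw [e0, hT]
  simp only [div_eq_mul_inv, mul_inv] at zero ⊢
  linear_combination zero

theorem stmt18 (q a b c d : ℂ) (hq : q ≠ 0) (hroot : ∀ m : ℕ, 1 ≤ m → q ^ m ≠ 1)
    (ha : a ≠ 0) (hb : b ≠ 0) (hc : c ≠ 0) (hd : d ≠ 0)
    (habcd : ∀ m : ℕ, a * b * c * d ≠ q⁻¹ ^ m) (hab1 : a * b ≠ 1) :
    ∀ n : ℕ, 1 ≤ n →
      Yop q a b c d (Cc (a * b / (a * b - 1)) * (AWP q a b c d n - Qpoly q a b c d n))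
        = Cc (q ^ (-(n : ℤ))) *
            (Cc (a * b / (a * b - 1)) * (AWP q a b c d n - Qpoly q a b c d n)) := by
  intro n hn
  obtain ⟨M, rfl⟩ : ∃ M, n = M + 1 := ⟨n - 1, by omega⟩
  rw [Yop, main_lemma q a b c d _ M hq hroot ha hb habcd,
    T1_lemma q a b c d _ (M + 1) hq ha hb, zpow_neg, zpow_natCast]

end
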